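/- arXiv:2406.05069 — 3 statements merged into one kernel-verified Lean document; each statement's English description precedes it below -/
import Mathlib

section
/- Let Q be an upper semilattice. The assignment V ↦ udim_V induces a group isomorphism from the Grothendieck group K(Persfp(Q)) of the category of discretisable Q-persistence modules onto the group F(Q,ℤ) of discretisable ℤ-valued functions on Q. -/
set_option maxHeartbeats 1000000

noncomputable section

open scoped BigOperators

/-- A pointwise finite-dimensional persistence module over a preordered set `P`:
a functor from `P` to finite-dimensional `K`-vector spaces. -/
structure PersMod (K : Type) [Field K] (P : Type) [Preorder P] where
  space : P → Type
  [inst_add : ∀ p, AddCommGroup (space p)]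
  [inst_mod : ∀ p, Module K (space p)]
  [inst_fin : ∀ p, Module.Finite K (space p)]
  map : ∀ {p q : P}, p ≤ q → (space p →ₗ[K] space q)
  map_refl : ∀ p : P, map (le_refl p) = LinearMap.id
  map_trans : ∀ {p q r : P} (h₁ : p ≤ q) (h₂ : q ≤ r),
      map (le_trans h₁ h₂) = (map h₂).comp (map h₁)

attribute [instance] PersMod.inst_add PersMod.inst_mod PersMod.inst_fin

variable {K : Type} [Field K] {P : Type} [Preorder P]

/-- The (real-valued) dimension vector of a persistence module. -/
def PersMod.udimR (V : PersMod K P) : P → ℝ := fun p => (Module.finrank K (V.space p) : ℝ)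

/-- A persistence module is nonzero if one of its spaces is nonzero. -/
def PersMod.IsNonzero (V : PersMod K P) : Prop := ∃ p, Module.finrank K (V.space p) ≠ 0

/-- Morphisms of persistence modules (natural transformations). -/
structure PersHom (V W : PersMod K P) where
  app : ∀ p, V.space p →ₗ[K] W.space p
  natural : ∀ {p q : P} (h : p ≤ q), (app q).comp (V.map h) = (W.map h).comp (app p)

/-- Persistence submodules (subfunctors). -/
structure PersSubmod (V : PersMod K P) where
  carrier : ∀ p, Submodule K (V.space p)
  stable : ∀ {p q : P} (h : p ≤ q), (carrier p).map (V.map h) ≤ carrier q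

namespace PersSubmod

variable {V : PersMod K P}

theorem ext' {S T : PersSubmod V} (h : ∀ p, S.carrier p = T.carrier p) : S = T := by
  cases S; cases T
  simp only [mk.injEq]
  funext p
  exact h p

instance : PartialOrder (PersSubmod V) where
  le S T := ∀ p, S.carrier p ≤ T.carrier p
  le_refl S p := le_rfl
  le_trans S T U h₁ h₂ p := (h₁ p).trans (h₂ p)
  le_antisymm S T h₁ h₂ := ext' fun p => le_antisymm (h₁ p) (h₂ p)

instance : Top (PersSubmod V) := ⟨⟨fun _ => ⊤, fun {p q} _ => le_top⟩⟩
instance : Bot (PersSubmod V) := ⟨⟨fun _ => ⊥, fun {p q} h => by simp⟩⟩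

/-- The (real-valued) dimension vector of a persistence submodule. -/
def dimQ (S : PersSubmod V) : P → ℝ := fun p => (Module.finrank K ↥(S.carrier p) : ℝ)

/-- The rank of the structure map `V_p → V_q` restricted to a persistence submodule. -/
def rankMap (S : PersSubmod V) {p q : P} (h : p ≤ q) : ℕ :=
  Module.finrank K ↥((S.carrier p).map (V.map h))

/-- The image of a persistence submodule under a morphism of persistence modules. -/
def mapHom {V W : PersMod K P} (f : PersHom V W) (S : PersSubmod V) : PersSubmod W where
  carrier p := (S.carrier p).map (f.app p)
  stable {p q} h := by
    calc ((S.carrier p).map (f.app p)).map (W.map h)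
        = (S.carrier p).map ((W.map h).comp (f.app p)) := (Submodule.map_comp _ _ _).symm
      _ = (S.carrier p).map ((f.app q).comp (V.map h)) := by rw [f.natural h]
      _ = ((S.carrier p).map (V.map h)).map (f.app q) := Submodule.map_comp _ _ _
      _ ≤ (S.carrier q).map (f.app q) := Submodule.map_mono (S.stable h)

end PersSubmod

/-- The slope of a dimension vector `d` along a (stability) function `Zc`:
the quotient of the imaginary part by the real part of `Zc d`. -/
def slopeOf {P : Type} (Zc : (P → ℝ) → ℂ) (d : P → ℝ) : ℝ := (Zc d).im / (Zc d).re

/-- Semistability of a persistence module along a stability condition `Zc`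
(given as a function of dimension vectors): every nonzero persistence submodule
has slope at most the slope of the whole module. -/
def IsSemistableP (Zc : (P → ℝ) → ℂ) (V : PersMod K P) : Prop :=
  ∀ S : PersSubmod V, (∃ p, S.carrier p ≠ ⊥) →
    slopeOf Zc S.dimQ ≤ slopeOf Zc V.udimR

/-- Dimension vector of the `i`-th subquotient of a chain of persistence submodules. -/
def qdim {V : PersMod K P} {ℓ : ℕ} (F : Fin (ℓ + 1) → PersSubmod V) (i : Fin ℓ) : P → ℝ :=
  (F i.succ).dimQ - (F i.castSucc).dimQ

/-- `F` is a Harder–Narasimhan filtration of `V` along `Zc`: a strictly increasing chain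
from `0` to `V` whose subquotients are semistable of strictly decreasing slopes.
(Semistability of the subquotient `F i.succ / F i.castSucc` is expressed, via the
correspondence theorem, in terms of the intermediate persistence submodules.) -/
structure IsHNFiltrationP (Zc : (P → ℝ) → ℂ) (V : PersMod K P) {ℓ : ℕ}
    (F : Fin (ℓ + 1) → PersSubmod V) : Prop where
  bot : F 0 = ⊥
  top : F (Fin.last ℓ) = ⊤
  lt : ∀ i : Fin ℓ, F i.castSucc < F i.succ
  semistable : ∀ (i : Fin ℓ) (W : PersSubmod V), F i.castSucc ≤ W → W ≤ F i.succ →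
      F i.castSucc < W →
      slopeOf Zc (W.dimQ - (F i.castSucc).dimQ) ≤ slopeOf Zc (qdim F i)
  slopes : ∀ i j : Fin ℓ, i < j → slopeOf Zc (qdim F j) < slopeOf Zc (qdim F i)

/-- `S` is the `θ`-piece `HN_Z^θ(V)` of a Harder–Narasimhan filtration of `V` along `Zc`:
`S = F i` where `i` is the largest index such that `i = 0` or the `i`-th subquotient has
slope `≥ θ`. -/
def IsHNPieceP (Zc : (P → ℝ) → ℂ) (V : PersMod K P) (θ : ℝ) (S : PersSubmod V) : Prop :=
  ∃ (ℓ : ℕ) (F : Fin (ℓ + 1) → PersSubmod V) (i : Fin (ℓ + 1)),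
    IsHNFiltrationP Zc V F ∧ S = F i ∧
    (∀ j : Fin ℓ, (j : ℕ) < (i : ℕ) → θ ≤ slopeOf Zc (qdim F j)) ∧
    (∀ j : Fin ℓ, (i : ℕ) ≤ (j : ℕ) → slopeOf Zc (qdim F j) < θ)

/-- `V` has a unique Harder–Narasimhan filtration along `Zc`. -/
def IsUniqueHN (Zc : (P → ℝ) → ℂ) (V : PersMod K P) : Prop :=
  ∃ (ℓ : ℕ) (F : Fin (ℓ + 1) → PersSubmod V), IsHNFiltrationP Zc V F ∧
    ∀ (ℓ' : ℕ) (F' : Fin (ℓ' + 1) → PersSubmod V), IsHNFiltrationP Zc V F' →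
      ℓ = ℓ' ∧ ∀ (k : ℕ) (h : k < ℓ + 1) (h' : k < ℓ' + 1), F ⟨k, h⟩ = F' ⟨k, h'⟩

section Semilattice

variable {Q : Type} [SemilatticeSup Q]

/-- `V` is discretised by the finite sup-closed subset `S ⊆ Q`, i.e. `V` is (isomorphic to)
the pushforward (left Kan extension) along the inclusion `S ↪ Q` of its restriction to `S`:
`V` vanishes where no element of `S` lies below, and its structure maps are isomorphisms
between any two points having the same set of elements of `S` below them. -/
def IsFinSLDiscretisedBy (K : Type) [Field K] (S : Finset Q) (V : PersMod K Q) : Prop :=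
  (∀ q : Q, (¬ ∃ p ∈ S, p ≤ q) → Module.finrank K (V.space q) = 0) ∧
  (∀ (q q' : Q) (h : q ≤ q'), (∀ p ∈ S, (p ≤ q ↔ p ≤ q')) →
      Function.Bijective (V.map h))

/-- `V` is discretisable (finitely presentable, i.e. lies in `Persfp(Q)`): it is the
pushforward of a persistence module over some finite (sup-closed) subposet of `Q`. -/
def IsDiscretisableSL (K : Type) [Field K] (Q : Type) [SemilatticeSup Q]
    (V : PersMod K Q) : Prop :=
  ∃ S : Finset Q, SupClosed (S : Set Q) ∧ IsFinSLDiscretisedBy K S V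

/-- A persistence submodule is discretised by `S`: it vanishes where no element of `S` lies
below, and it is carried onto itself by the structure isomorphisms within each cell. -/
def PersSubmod.DiscretisedBy {V : PersMod K Q} (S : Finset Q) (F : PersSubmod V) : Prop :=
  (∀ q : Q, (¬ ∃ p ∈ S, p ≤ q) → F.carrier q = ⊥) ∧
  (∀ (q q' : Q) (h : q ≤ q'), (∀ p ∈ S, (p ≤ q ↔ p ≤ q')) →
      (F.carrier q).map (V.map h) = F.carrier q')

/-- Restriction (pullback) of a persistence module to a finite subposet. -/
def PersMod.restrictS (V : PersMod K Q) (S : Finset Q) : PersMod K {p : Q // p ∈ S} where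
  space p := V.space p.1
  map {p q} h := V.map (Subtype.coe_le_coe.mpr h)
  map_refl p := V.map_refl p.1
  map_trans h₁ h₂ := V.map_trans _ _

/-- Restriction of a persistence submodule to a finite subposet. -/
def PersSubmod.restrictS {V : PersMod K Q} (F : PersSubmod V) (S : Finset Q) :
    PersSubmod (V.restrictS S) where
  carrier p := F.carrier p.1
  stable {p q} h := F.stable _

open Classical in
/-- Extension of a function on a finite subposet `S` to `Q` by `d(q) = d(⌊q⌋_S)`, where
`⌊q⌋_S` is the join of all elements of `S` below `q` (and `0` if there are none).
This is the dimension vector of the pushforward. -/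
noncomputable def floorExtend (S : Finset Q) (d : {p : Q // p ∈ S} → ℝ) (q : Q) : ℝ :=
  if h : (S.filter (fun p => p ≤ q)).Nonempty then
    (if hm : (S.filter (fun p => p ≤ q)).sup' h id ∈ S then d ⟨_, hm⟩ else 0)
  else 0

/-- The pullback `f^*Z` of a stability condition along the inclusion `f : S ↪ Q` of a finite
subposet, defined by `f^*Z([U]) = Z([f_* U])`. -/
noncomputable def pullbackZSL (Zc : (Q → ℝ) → ℂ) (S : Finset Q) :
    ({p : Q // p ∈ S} → ℝ) → ℂ := fun d => Zc (floorExtend S d)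

end Semilattice

end

noncomputable section

variable {K : Type} [Field K] {Q : Type} [SemilatticeSup Q]

/-- A short exact sequence `0 → A → B → C → 0` of persistence modules
(pointwise injective/surjective with exactness in the middle). -/
structure PersSES (A B C : PersMod K Q) where
  ι : PersHom A B
  π : PersHom B C
  inj : ∀ q, Function.Injective (ι.app q)
  surj : ∀ q, Function.Surjective (π.app q)
  exact : ∀ q, LinearMap.range (ι.app q) = LinearMap.ker (π.app q)

/-- The type of discretisable (finitely presentable) `Q`-persistence modules,
i.e. objects of `Persfp(Q)`. -/
def DiscMod (K : Type) [Field K] (Q : Type) [SemilatticeSup Q] :=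
  {V : PersMod K Q // IsDiscretisableSL K Q V}

/-- The defining relations `[B] = [A] + [C]` of the Grothendieck group of `Persfp(Q)`. -/
def K0fpRel (K : Type) [Field K] (Q : Type) [SemilatticeSup Q] :
    AddSubgroup (FreeAbelianGroup (DiscMod K Q)) :=
  AddSubgroup.closure {x | ∃ A B C : DiscMod K Q, Nonempty (PersSES A.1 B.1 C.1) ∧
    x = FreeAbelianGroup.of B - FreeAbelianGroup.of A - FreeAbelianGroup.of C}

/-- The Grothendieck group `K(Persfp(Q))` of the category of discretisable
`Q`-persistence modules. -/
def K0fp (K : Type) [Field K] (Q : Type) [SemilatticeSup Q] :=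
  FreeAbelianGroup (DiscMod K Q) ⧸ K0fpRel K Q

instance : AddCommGroup (K0fp K Q) := QuotientAddGroup.Quotient.addCommGroup _

/-- The canonical projection onto the Grothendieck group. -/
def K0fpMk (K : Type) [Field K] (Q : Type) [SemilatticeSup Q] :
    FreeAbelianGroup (DiscMod K Q) →+ K0fp K Q :=
  QuotientAddGroup.mk' _

/-- `a : Q → ℤ` is a discretisable function: it is induced from a function on a finite
(sup-closed) subposet `S` of `Q` via the floor `⌊·⌋_S` (with value `0` where the floor is
`-∞`). These functions form the group `F(Q, ℤ)`. -/
def IsDiscretisableFun (a : Q → ℤ) : Prop :=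
  ∃ S : Finset Q, SupClosed (S : Set Q) ∧
    (∀ q : Q, (¬ ∃ p ∈ S, p ≤ q) → a q = 0) ∧
    (∀ q q' : Q, (∀ p ∈ S, (p ≤ q ↔ p ≤ q')) → a q = a q')

section Devissage

/-- The dimension vector of a persistence module, as an integer-valued function. -/
def udimZ (V : PersMod K Q) : Q → ℤ := fun q => (Module.finrank K (V.space q) : ℤ)

theorem PersSES.udimZ_eq {A B C : PersMod K Q} (E : PersSES A B C) :
    udimZ B = udimZ A + udimZ C := by
  funext q
  have h := LinearMap.finrank_range_add_finrank_ker (E.π.app q)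
  rw [LinearMap.range_eq_top.2 (E.surj q), finrank_top, ← E.exact q,
    LinearMap.finrank_range_of_inj (E.inj q)] at h
  simp only [udimZ, Pi.add_apply]
  omega

/-- The class of a discretisable module in the Grothendieck group. -/
def K0fpClass (V : DiscMod K Q) : K0fp K Q := K0fpMk K Q (FreeAbelianGroup.of V)

theorem PersSES.k0fpClass_eq {A B C : DiscMod K Q} (E : PersSES A.1 B.1 C.1) :
    K0fpClass B = K0fpClass A + K0fpClass C := by
  have h : K0fpMk K Q (FreeAbelianGroup.of B - FreeAbelianGroup.of A -
      FreeAbelianGroup.of C) = 0 :=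
    (QuotientAddGroup.eq_zero_iff _).2 (AddSubgroup.subset_closure ⟨A, B, C, ⟨E⟩, rfl⟩)
  rw [map_sub, map_sub, sub_sub, sub_eq_zero] at h
  exact h

/-- The homomorphism `K(Persfp(Q)) → (Q → ℤ)` induced by the dimension vector. -/
def K0fpDim (K : Type) [Field K] (Q : Type) [SemilatticeSup Q] : K0fp K Q →+ (Q → ℤ) :=
  QuotientAddGroup.lift (K0fpRel K Q) (FreeAbelianGroup.lift fun V => udimZ V.1) <| by
    rw [K0fpRel, AddSubgroup.closure_le]
    rintro x ⟨A, B, C, ⟨E⟩, rfl⟩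
    simp [E.udimZ_eq]

theorem K0fpDim_class (V : DiscMod K Q) : K0fpDim K Q (K0fpClass V) = udimZ V.1 :=
  FreeAbelianGroup.lift_apply_of (fun V : DiscMod K Q => udimZ V.1) V

open Classical in
/-- The interval module of a convex subset `C`, with value `K` on `C` and `0` elsewhere. -/
def intervalMod (K : Type) [Field K] (C : Set Q) (hC : C.OrdConnected) : PersMod K Q where
  space q := PLift (q ∈ C) → K
  map {p q} _ :=
    { toFun := fun f _ => if hp : p ∈ C then f ⟨hp⟩ else 0
      map_add' := fun f g => by funext; by_cases hp : p ∈ C <;> simp [hp]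
      map_smul' := fun c f => by funext; by_cases hp : p ∈ C <;> simp [hp] }
  map_refl p := by
    ext f ⟨hp⟩
    simp [hp]
  map_trans {p q r} h₁ h₂ := by
    refine LinearMap.ext fun f => funext fun hr => ?_
    by_cases hp : p ∈ C
    · have hq : q ∈ C := hC.out hp hr.down ⟨h₁, h₂⟩
      simp [hp, hq]
    · simp [hp]

theorem intervalMod_map_apply {C : Set Q} {hC : C.OrdConnected} {p q : Q} (h : p ≤ q)
    (hp : p ∈ C) (hq : q ∈ C) (f : (intervalMod K C hC).space p) :
    (intervalMod K C hC).map h f ⟨hq⟩ = f ⟨hp⟩ :=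
  dif_pos hp

theorem intervalMod_map_apply_of_notMem {C : Set Q} {hC : C.OrdConnected} {p q : Q}
    (h : p ≤ q) (hp : p ∉ C) (hq : q ∈ C) (f : (intervalMod K C hC).space p) :
    (intervalMod K C hC).map h f ⟨hq⟩ = 0 :=
  dif_neg hp

open Classical in
theorem finrank_intervalMod (C : Set Q) (hC : C.OrdConnected) (q : Q) :
    Module.finrank K ((intervalMod K C hC).space q) = if q ∈ C then 1 else 0 := by
  change Module.finrank K (PLift (q ∈ C) → K) = _
  rw [Module.finrank_fintype_fun_eq_card]
  by_cases hq : q ∈ C <;> simp [hq]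

/-- The set of points having the same elements of `S` below them as `s`. -/
def cell (S : Finset Q) (s : Q) : Set Q := {q | ∀ p ∈ S, p ≤ q ↔ p ≤ s}

theorem cell_ordConnected (S : Finset Q) (s : Q) : (cell S s).OrdConnected :=
  ⟨fun _ hx _ hy _ hz p hp =>
    ⟨fun h => (hy p hp).1 (h.trans hz.2), fun h => ((hx p hp).2 h).trans hz.1⟩⟩

theorem le_of_mem_cell {S : Finset Q} {s q : Q} (hs : s ∈ S) (hq : q ∈ cell S s) : s ≤ q :=
  (hq s hs).2 le_rfl

theorem mem_cell_iff_eq {S : Finset Q} {s t : Q} (hs : s ∈ S) (ht : t ∈ S) :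
    s ∈ cell S t ↔ s = t := by
  refine ⟨fun h => le_antisymm ((h s hs).1 le_rfl) (le_of_mem_cell ht h), ?_⟩
  rintro rfl p _
  rfl

theorem exists_mem_le_mem_cell {S : Finset Q} (hS : SupClosed (S : Set Q)) {q : Q}
    (hq : ∃ p ∈ S, p ≤ q) : ∃ t ∈ S, t ≤ q ∧ q ∈ cell S t := by
  classical
  have hne : (S.filter (· ≤ q)).Nonempty := by
    obtain ⟨p, hp, hpq⟩ := hq
    exact ⟨p, Finset.mem_filter.2 ⟨hp, hpq⟩⟩
  have hle : (S.filter (· ≤ q)).sup' hne id ≤ q :=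
    Finset.sup'_le _ _ fun p hp => (Finset.mem_filter.1 hp).2
  refine ⟨_, hS.finsetSup'_mem hne fun p hp => (Finset.mem_filter.1 hp).1, hle, fun p hp =>
    ⟨fun h => ?_, fun h => h.trans hle⟩⟩
  exact Finset.le_sup' id (Finset.mem_filter.2 ⟨hp, h⟩)

theorem IsFinSLDiscretisedBy.mono {S S' : Finset Q} {V : PersMod K Q}
    (hV : IsFinSLDiscretisedBy K S V) (hSS' : S ⊆ S') : IsFinSLDiscretisedBy K S' V :=
  ⟨fun q hq => hV.1 q fun ⟨p, hp, hpq⟩ => hq ⟨p, hSS' hp, hpq⟩,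
    fun q q' h hqq' => hV.2 q q' h fun p hp => hqq' p (hSS' hp)⟩

theorem intervalMod_cell_discretisedBy {S : Finset Q} {s : Q} (hs : s ∈ S) :
    IsFinSLDiscretisedBy K S (intervalMod K (cell S s) (cell_ordConnected S s)) := by
  classical
  refine ⟨fun q hq => ?_, fun q q' h hqq' => ?_⟩
  · rw [finrank_intervalMod, if_neg fun hqs => hq ⟨s, hs, le_of_mem_cell hs hqs⟩]
  · have hiff : q ∈ cell S s ↔ q' ∈ cell S s :=
      forall₂_congr fun p hp => by rw [hqq' p hp]
    refine ⟨fun f g hfg => funext fun hq => ?_, fun g => ⟨fun hq => g ⟨hiff.1 hq.down⟩, ?_⟩⟩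
    · have := congrFun hfg ⟨hiff.1 hq.down⟩
      rwa [intervalMod_map_apply h hq.down, intervalMod_map_apply h hq.down] at this
    · exact funext fun hq' => intervalMod_map_apply h (hiff.2 hq'.down) hq'.down _

/-- The interval module of the cell of `s ∈ S`, as a discretisable module. -/
def cellMod (K : Type) [Field K] {S : Finset Q} (hS : SupClosed (S : Set Q))
    (s : {s // s ∈ S}) : DiscMod K Q :=
  ⟨intervalMod K (cell S s.1) (cell_ordConnected S s.1), S, hS,
    intervalMod_cell_discretisedBy s.2⟩

open Classical in
theorem udimZ_cellMod {S : Finset Q} (hS : SupClosed (S : Set Q)) (s : {s // s ∈ S}) (q : Q) :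
    udimZ (cellMod K hS s).1 q = if q ∈ cell S s.1 then 1 else 0 := by
  change (Module.finrank K
    ((intervalMod K (cell S s.1) (cell_ordConnected S s.1)).space q) : ℤ) = _
  rw [finrank_intervalMod]
  split_ifs <;> rfl

/-- The quotient of a persistence module by a persistence submodule. -/
def PersSubmod.quotient {V : PersMod K Q} (W : PersSubmod V) : PersMod K Q where
  space q := V.space q ⧸ W.carrier q
  map {p q} h := Submodule.mapQ _ _ (V.map h) (Submodule.map_le_iff_le_comap.1 (W.stable h))
  map_refl p := by
    ext x
    simp [V.map_refl]
  map_trans h₁ h₂ := by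
    ext x
    simp [V.map_trans h₁ h₂]

theorem PersSubmod.DiscretisedBy.quotient {S : Finset Q} {V : PersMod K Q} {W : PersSubmod V}
    (hW : W.DiscretisedBy S) (hV : IsFinSLDiscretisedBy K S V) :
    IsFinSLDiscretisedBy K S W.quotient := by
  refine ⟨fun q hq => ?_, fun q q' h hqq' => ⟨?_, ?_⟩⟩
  · have := Submodule.finrank_quotient_le (W.carrier q)
    rw [hV.1 q hq] at this
    exact Nat.le_zero.1 this
  · refine (injective_iff_map_eq_zero (W.quotient.map h)).2 fun x => ?_
    obtain ⟨x, rfl⟩ := Submodule.mkQ_surjective _ x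
    intro hx
    have hx' : V.map h x ∈ W.carrier q' := (Submodule.Quotient.mk_eq_zero _).1 hx
    rw [← hW.2 q q' h hqq'] at hx'
    obtain ⟨y, hy, hyx⟩ := hx'
    rw [(hV.2 q q' h hqq').1 hyx] at hy
    exact (Submodule.Quotient.mk_eq_zero _).2 hy
  · intro y
    obtain ⟨y, rfl⟩ := Submodule.mkQ_surjective _ y
    obtain ⟨x, rfl⟩ := (hV.2 q q' h hqq').2 y
    exact ⟨Submodule.Quotient.mk x, rfl⟩

/-- The image of a morphism of persistence modules. -/
def PersHom.range {V W : PersMod K Q} (f : PersHom V W) : PersSubmod W :=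
  PersSubmod.mapHom f ⊤

theorem PersHom.range_carrier {V W : PersMod K Q} (f : PersHom V W) (q : Q) :
    f.range.carrier q = LinearMap.range (f.app q) :=
  Submodule.map_top _

theorem PersHom.range_discretisedBy {S : Finset Q} {V W : PersMod K Q} (f : PersHom V W)
    (hV : IsFinSLDiscretisedBy K S V) : f.range.DiscretisedBy S := by
  refine ⟨fun q hq => ?_, fun q q' h hqq' => ?_⟩
  · have := Module.finrank_zero_iff.1 (hV.1 q hq)
    rw [f.range_carrier, LinearMap.range_eq_bot]
    exact LinearMap.ext fun x => by rw [Subsingleton.elim x 0, map_zero, map_zero]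
  · rw [f.range_carrier, f.range_carrier, ← LinearMap.range_comp, ← f.natural h,
      LinearMap.range_comp, LinearMap.range_eq_top.2 (hV.2 q q' h hqq').2, Submodule.map_top]

/-- The short exact sequence of an injective morphism and its cokernel. -/
def PersHom.cokernelSES {V W : PersMod K Q} (f : PersHom V W)
    (hf : ∀ q, Function.Injective (f.app q)) : PersSES V W f.range.quotient where
  ι := f
  π := { app := fun q => (f.range.carrier q).mkQ
         natural := fun _ => rfl }
  inj := hf
  surj _ := Submodule.mkQ_surjective _
  exact q := by
    rw [← f.range_carrier]
    exact (Submodule.ker_mkQ _).symm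

theorem IsFinSLDiscretisedBy.finrank_eq_of_le_of_mem_cell {S : Finset Q} {V : PersMod K Q}
    (hV : IsFinSLDiscretisedBy K S V) {t q : Q} (htq : t ≤ q) (hq : q ∈ cell S t) :
    Module.finrank K (V.space t) = Module.finrank K (V.space q) :=
  (LinearEquiv.ofBijective _ (hV.2 t q htq fun p hp => (hq p hp).symm)).finrank_eq

theorem IsFinSLDiscretisedBy.finrank_eq_zero {S : Finset Q} (hS : SupClosed (S : Set Q))
    {V : PersMod K Q} (hV : IsFinSLDiscretisedBy K S V) {q : Q}
    (h : ∀ t ∈ S, t ≤ q → q ∈ cell S t → Module.finrank K (V.space t) = 0) :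
    Module.finrank K (V.space q) = 0 := by
  by_cases hq : ∃ p ∈ S, p ≤ q
  · obtain ⟨t, ht, htq, hqt⟩ := exists_mem_le_mem_cell hS hq
    rw [← hV.finrank_eq_of_le_of_mem_cell htq hqt, h t ht htq hqt]
  · exact hV.1 q hq

open Classical in
/-- The morphism from the interval module of the cell of `s` to `V` determined by an element
of `V_s`, when `V` vanishes above `s` outside of the cell. -/
def homOfCell {S : Finset Q} {s : Q} (hs : s ∈ S) (V : PersMod K Q)
    (hV : ∀ q, s ≤ q → q ∉ cell S s → Module.finrank K (V.space q) = 0) (v : V.space s) :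
    PersHom (intervalMod K (cell S s) (cell_ordConnected S s)) V where
  app q :=
    if hq : q ∈ cell S s then
      LinearMap.smulRight (LinearMap.proj (R := K) (φ := fun _ : PLift (q ∈ cell S s) => K) ⟨hq⟩)
        (V.map (le_of_mem_cell hs hq) v)
    else 0
  natural {p q} h := by
    refine LinearMap.ext fun f => ?_
    by_cases hq : q ∈ cell S s
    · by_cases hp : p ∈ cell S s
      · rw [dif_pos hq, dif_pos hp]
        change ((intervalMod K _ _).map h f ⟨hq⟩) • _ = V.map h (f ⟨hp⟩ • _)
        rw [intervalMod_map_apply h hp hq, map_smul, V.map_trans (le_of_mem_cell hs hp) h]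
        rfl
      · rw [dif_pos hq, dif_neg hp]
        change ((intervalMod K _ _).map h f ⟨hq⟩) • _ = V.map h 0
        rw [intervalMod_map_apply_of_notMem h hp hq, zero_smul, map_zero]
    · by_cases hp : p ∈ cell S s
      · have := Module.finrank_zero_iff.1 (hV q ((le_of_mem_cell hs hp).trans h) hq)
        exact Subsingleton.elim _ _
      · rw [dif_neg hq, dif_neg hp]
        simp

theorem homOfCell_injective {S : Finset Q} {s : Q} (hs : s ∈ S) (V : PersMod K Q)
    (hV : ∀ q, s ≤ q → q ∉ cell S s → Module.finrank K (V.space q) = 0) {v : V.space s}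
    (hv : ∀ q (hq : q ∈ cell S s), V.map (le_of_mem_cell hs hq) v ≠ 0) (q : Q) :
    Function.Injective ((homOfCell hs V hV v).app q) := by
  intro f g hfg
  funext hq
  simp only [homOfCell, dif_pos hq.down] at hfg
  exact smul_left_injective K (hv q hq.down) hfg

theorem k0fpClass_eq_zero (V : DiscMod K Q) (hV : ∀ q, Module.finrank K (V.1.space q) = 0) :
    K0fpClass V = 0 := by
  have := fun q => Module.finrank_zero_iff.1 (hV q)
  let f : PersHom V.1 V.1 := ⟨fun _ => LinearMap.id, fun _ => rfl⟩
  have E : PersSES V.1 V.1 V.1 :=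
    { ι := f
      π := f
      inj := fun _ => Function.injective_id
      surj := fun _ => Function.surjective_id
      exact := fun _ => Subsingleton.elim _ _ }
  simpa using E.k0fpClass_eq

/-- The combination of classes of cell modules with coefficients the values of `a` on `S`. -/
def cellSum (K : Type) [Field K] {S : Finset Q} (hS : SupClosed (S : Set Q)) :
    (Q → ℤ) →+ K0fp K Q where
  toFun a := ∑ s : {s // s ∈ S}, a s.1 • K0fpClass (cellMod K hS s)
  map_zero' := by simp
  map_add' a b := by simp [add_smul, Finset.sum_add_distrib]

theorem cellSum_udimZ_cellMod {S : Finset Q} (hS : SupClosed (S : Set Q)) (t : {s // s ∈ S}) :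
    cellSum K hS (udimZ (cellMod K hS t).1) = K0fpClass (cellMod K hS t) := by
  classical
  simp [cellSum, udimZ_cellMod, mem_cell_iff_eq]

theorem k0fpClass_eq_cellSum {S : Finset Q} (hS : SupClosed (S : Set Q)) (V : DiscMod K Q)
    (hV : IsFinSLDiscretisedBy K S V.1) : K0fpClass V = cellSum K hS (udimZ V.1) := by
  classical
  induction hn : ∑ s ∈ S, Module.finrank K (V.1.space s) using Nat.strong_induction_on
    generalizing V with
  | _ n ih =>
  by_cases h0 : ∀ s ∈ S, Module.finrank K (V.1.space s) = 0
  · have hz : ∀ q, Module.finrank K (V.1.space q) = 0 :=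
      fun q => hV.finrank_eq_zero hS fun t ht _ _ => h0 t ht
    have hu : udimZ V.1 = 0 := funext fun q => by simp [udimZ, hz]
    rw [k0fpClass_eq_zero V hz, hu, map_zero]
  · push Not at h0
    obtain ⟨s, hs⟩ := (S.filter fun s => Module.finrank K (V.1.space s) ≠ 0).exists_maximal
      (by obtain ⟨s, hs, hs'⟩ := h0; exact ⟨s, Finset.mem_filter.2 ⟨hs, hs'⟩⟩)
    obtain ⟨hsS, hs0⟩ := Finset.mem_filter.1 hs.prop
    have hvan : ∀ q, s ≤ q → q ∉ cell S s → Module.finrank K (V.1.space q) = 0 := by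
      intro q hsq hq
      refine hV.finrank_eq_zero hS fun t ht htq hqt => ?_
      by_contra hne
      have hst : s ≤ t := (hqt s hsS).1 hsq
      have hts : t ≤ s := hs.le_of_ge (Finset.mem_filter.2 ⟨ht, hne⟩) hst
      exact hq (le_antisymm hts hst ▸ hqt)
    have : Nontrivial (V.1.space s) :=
      Module.nontrivial_of_finrank_pos (Nat.pos_of_ne_zero hs0)
    obtain ⟨v, hv⟩ := exists_ne (0 : V.1.space s)
    have hinj := homOfCell_injective hsS V.1 hvan (v := v) fun q hq hvq =>
      hv ((hV.2 s q (le_of_mem_cell hsS hq) fun p hp => (hq p hp).symm).1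
        (hvq.trans (map_zero _).symm))
    let f := homOfCell hsS V.1 hvan v
    have hC : IsFinSLDiscretisedBy K S f.range.quotient :=
      (f.range_discretisedBy (intervalMod_cell_discretisedBy hsS)).quotient hV
    let C : DiscMod K Q := ⟨f.range.quotient, S, hS, hC⟩
    let E : PersSES (cellMod K hS ⟨s, hsS⟩).1 V.1 C.1 := f.cokernelSES hinj
    have hlt : ∑ t ∈ S, Module.finrank K (C.1.space t) < n := by
      rw [← hn]
      refine Finset.sum_lt_sum (fun t _ => Submodule.finrank_quotient_le _) ⟨s, hsS, ?_⟩
      have h := congrFun E.udimZ_eq s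
      rw [Pi.add_apply, udimZ_cellMod, if_pos ((mem_cell_iff_eq hsS hsS).2 rfl)] at h
      simp only [udimZ] at h
      omega
    rw [E.k0fpClass_eq, E.udimZ_eq, map_add, cellSum_udimZ_cellMod, ih _ hlt C hC rfl]

theorem exists_supClosed_superset (S : Finset Q) :
    ∃ T : Finset Q, SupClosed (T : Set Q) ∧ S ⊆ T := by
  have hfin : (supClosure (S : Set Q)).Finite := S.finite_toSet.supClosure
  refine ⟨hfin.toFinset, by simp, fun x hx => ?_⟩
  exact hfin.mem_toFinset.2 (subset_supClosure (Finset.mem_coe.2 hx))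

theorem exists_eq_cellSum (x : K0fp K Q) :
    ∃ S : Finset Q, ∀ T : Finset Q, S ⊆ T → ∀ hT : SupClosed (T : Set Q),
      x = cellSum K hT (K0fpDim K Q x) := by
  classical
  obtain ⟨y, rfl⟩ := QuotientAddGroup.mk'_surjective (K0fpRel K Q) x
  change ∃ S : Finset Q, ∀ T : Finset Q, S ⊆ T → ∀ hT : SupClosed (T : Set Q),
    K0fpMk K Q y = cellSum K hT (K0fpDim K Q (K0fpMk K Q y))
  induction y using FreeAbelianGroup.induction_on with
  | zero => exact ⟨∅, fun T _ hT => by simp only [map_zero]⟩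
  | of V =>
    obtain ⟨S, _, hV⟩ := V.2
    refine ⟨S, fun T hST hT => ?_⟩
    change K0fpClass V = cellSum K hT (K0fpDim K Q (K0fpClass V))
    rw [K0fpDim_class]
    exact k0fpClass_eq_cellSum hT V (hV.mono hST)
  | neg V ih =>
    obtain ⟨S, h⟩ := ih
    refine ⟨S, fun T hST hT => ?_⟩
    simp only [map_neg]
    rw [← h T hST hT]
  | add y z hy hz =>
    obtain ⟨S, hS⟩ := hy
    obtain ⟨S', hS'⟩ := hz
    refine ⟨S ∪ S', fun T hST hT => ?_⟩
    simp only [map_add]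
    rw [← hS T (Finset.union_subset_left hST) hT, ← hS' T (Finset.union_subset_right hST) hT]

theorem K0fpDim_cellSum {S : Finset Q} (hS : SupClosed (S : Set Q)) (a : Q → ℤ) :
    K0fpDim K Q (cellSum K hS a) =
      ∑ s : {s // s ∈ S}, a s.1 • udimZ (cellMod K hS s).1 := by
  change K0fpDim K Q (∑ s : {s // s ∈ S}, a s.1 • K0fpClass (cellMod K hS s)) = _
  simp only [map_sum, map_zsmul, K0fpDim_class]

theorem isDiscretisableFun_K0fpDim_cellSum {S : Finset Q} (hS : SupClosed (S : Set Q))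
    (a : Q → ℤ) : IsDiscretisableFun (K0fpDim K Q (cellSum K hS a)) := by
  classical
  refine ⟨S, hS, fun q hq => ?_, fun q q' h => ?_⟩
  · rw [K0fpDim_cellSum, Finset.sum_apply]
    refine Finset.sum_eq_zero fun s _ => ?_
    rw [Pi.smul_apply, udimZ_cellMod,
      if_neg fun hqs => hq ⟨s, s.2, le_of_mem_cell s.2 hqs⟩, smul_zero]
  · simp only [K0fpDim_cellSum, Finset.sum_apply, Pi.smul_apply, udimZ_cellMod]
    refine Finset.sum_congr rfl fun s _ => ?_
    have hiff : q ∈ cell S s.1 ↔ q' ∈ cell S s.1 := forall₂_congr fun p hp => by rw [h p hp]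
    simp only [hiff]

theorem K0fpDim_cellSum_eq {S : Finset Q} (hS : SupClosed (S : Set Q)) {a : Q → ℤ}
    (ha₀ : ∀ q : Q, (¬ ∃ p ∈ S, p ≤ q) → a q = 0)
    (ha : ∀ q q' : Q, (∀ p ∈ S, (p ≤ q ↔ p ≤ q')) → a q = a q') :
    K0fpDim K Q (cellSum K hS a) = a := by
  classical
  funext q
  simp only [K0fpDim_cellSum, Finset.sum_apply, Pi.smul_apply, udimZ_cellMod]
  by_cases hq : ∃ p ∈ S, p ≤ q
  · obtain ⟨t, ht, htq, hqt⟩ := exists_mem_le_mem_cell hS hq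
    rw [Finset.sum_eq_single ⟨t, ht⟩]
    · rw [if_pos hqt, smul_eq_mul, mul_one]
      exact (ha q t hqt).symm
    · intro s _ hst
      rw [if_neg, smul_zero]
      intro hqs
      exact hst (Subtype.ext (le_antisymm ((hqt s s.2).1 (le_of_mem_cell s.2 hqs))
        ((hqs t ht).1 htq)))
    · exact fun h => absurd (Finset.mem_univ _) h
  · rw [ha₀ q hq]
    refine Finset.sum_eq_zero fun s _ => ?_
    rw [if_neg fun hqs => hq ⟨s, s.2, le_of_mem_cell s.2 hqs⟩, smul_zero]

end Devissage

/-- Let `Q` be an upper semilattice. The assignment `V ↦ udim_V`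
induces a group isomorphism from the Grothendieck group `K(Persfp(Q))` onto the group
`F(Q,ℤ)` of discretisable `ℤ`-valued functions on `Q`: there is a group homomorphism
from `K(Persfp(Q))` to functions `Q → ℤ` sending `[V]` to `udim_V`, which is injective
and has image exactly `F(Q,ℤ)`. -/
theorem grothendieck_group_iso_discretisable_functions
    (K : Type) [Field K] (Q : Type) [SemilatticeSup Q] :
    ∃ φ : K0fp K Q →+ (Q → ℤ),
      (∀ V : DiscMod K Q, φ (K0fpMk K Q (FreeAbelianGroup.of V)) =
        fun q => (Module.finrank K (V.1.space q) : ℤ)) ∧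
      Function.Injective φ ∧
      Set.range φ = {a : Q → ℤ | IsDiscretisableFun a} := by
  refine ⟨K0fpDim K Q, K0fpDim_class, ?_, ?_⟩
  · refine (injective_iff_map_eq_zero _).2 fun x hx => ?_
    obtain ⟨S, hS⟩ := exists_eq_cellSum x
    obtain ⟨T, hT, hST⟩ := exists_supClosed_superset S
    rw [hS T hST hT, hx, map_zero]
  · ext a
    constructor
    · rintro ⟨x, rfl⟩
      obtain ⟨S, hS⟩ := exists_eq_cellSum x
      obtain ⟨T, hT, hST⟩ := exists_supClosed_superset S
      rw [hS T hST hT]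
      exact isDiscretisableFun_K0fpDim_cellSum hT _
    · rintro ⟨S, hS, ha₀, ha⟩
      exact ⟨_, K0fpDim_cellSum_eq hS ha₀ ha⟩

end
end

section
/- Let A be an abelian category and Z a stability condition over A. (i) When they exist, HN filtrations along Z are unique. (ii) If A contains no infinite descending chain of subobjects ⋯ ⊆ V_{j+1} ⊆ V_j ⊆ ⋯ ⊆ V_1 with μ_Z(V_{j+1}) > μ_Z(V_j) for all j, and no infinite sequence of epimorphisms V_1 ↠ V_2 ↠ ⋯ ↠ V_j ↠ V_{j+1} ↠ ⋯ with μ_Z(V_j) > μ_Z(V_{j+1}) for all j, then every nonzero object of A has a unique HN filtration along Z. -/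
set_option maxHeartbeats 1000000

noncomputable section

open CategoryTheory CategoryTheory.Limits

universe v u v' u'

/-- A stability condition on an abelian category `A`: an additive function on objects
(equivalently, a group homomorphism from the Grothendieck group `K(A)` to `(ℂ, +)`)
sending nonzero objects into the open right half-plane. -/
structure AddStab (A : Type u) [Category.{v} A] [Abelian A] where
  val : A → ℂ
  additive : ∀ S : ShortComplex A, S.ShortExact → val S.X₂ = val S.X₁ + val S.X₃
  posRe : ∀ X : A, ¬ IsZero X → 0 < (val X).re

variable {A : Type u} [Category.{v} A] [Abelian A]

/-- The slope of an object along a `ℂ`-valued function on objects. -/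
def slopeObj (f : A → ℂ) (X : A) : ℝ := (f X).im / (f X).re

/-- Semistability of an object along a `ℂ`-valued function on objects:
every nonzero subobject has slope at most the slope of the object. -/
def SemistableF (f : A → ℂ) (X : A) : Prop :=
  ∀ (W : A) (ι : W ⟶ X), Mono ι → ¬ IsZero W → slopeObj f W ≤ slopeObj f X

/-- The `i`-th subquotient of a chain of subobjects (the cokernel of the inclusion
of the `i`-th into the `(i+1)`-st subobject). -/
noncomputable def hnQuot {X : A} {ℓ : ℕ} (F : Fin (ℓ + 1) → Subobject X) (i : Fin ℓ) : A :=
  cokernel (Subobject.ofLE (F i.castSucc ⊓ F i.succ) (F i.succ) inf_le_right)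

/-- `F` is a Harder–Narasimhan filtration along the stability function `f`: a strictly
increasing finite chain `0 = F 0 ⊊ ⋯ ⊊ F ℓ = X` of subobjects with semistable
subquotients of strictly decreasing slopes. -/
structure IsHNFilt (f : A → ℂ) (X : A) {ℓ : ℕ} (F : Fin (ℓ + 1) → Subobject X) : Prop where
  bot : F 0 = ⊥
  top : F (Fin.last ℓ) = ⊤
  lt : ∀ i : Fin ℓ, F i.castSucc < F i.succ
  semistable : ∀ i : Fin ℓ, SemistableF f (hnQuot F i)
  slopes : ∀ i j : Fin ℓ, i < j → slopeObj f (hnQuot F j) < slopeObj f (hnQuot F i)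

/-- The defining relations of the Grothendieck group of an abelian category. -/
def K0Rel (A : Type u) [Category.{v} A] [Abelian A] : AddSubgroup (FreeAbelianGroup A) :=
  AddSubgroup.closure {x | ∃ S : ShortComplex A, S.ShortExact ∧
    x = FreeAbelianGroup.of S.X₂ - FreeAbelianGroup.of S.X₁ - FreeAbelianGroup.of S.X₃}

/-- The Grothendieck group `K(A)` of an abelian category `A`. -/
def K0 (A : Type u) [Category.{v} A] [Abelian A] :=
  FreeAbelianGroup A ⧸ K0Rel A

instance : AddCommGroup (K0 A) := QuotientAddGroup.Quotient.addCommGroup _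

/-- The canonical projection `FreeAbelianGroup A →+ K(A)`, sending `[V]` to its class. -/
def K0Mk (A : Type u) [Category.{v} A] [Abelian A] : FreeAbelianGroup A →+ K0 A :=
  QuotientAddGroup.mk' _

/-- The statement that the group homomorphism `K(A) → K(A')` induced by `F` is
(well-defined and) injective. -/
def K0Injective {A' : Type u'} [Category.{v'} A'] [Abelian A'] (F : A ⥤ A') : Prop :=
  ∀ x y : FreeAbelianGroup A,
    K0Mk A' (FreeAbelianGroup.map F.obj x) = K0Mk A' (FreeAbelianGroup.map F.obj y) →
    K0Mk A x = K0Mk A y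

/-- The image of a subobject under an (exact) functor. -/
noncomputable def mapSubobj {A' : Type u'} [Category.{v'} A'] [Abelian A']
    (F : A ⥤ A') [F.PreservesMonomorphisms] {X : A} (S : Subobject X) :
    Subobject (F.obj X) :=
  haveI : Mono (F.map S.arrow) := F.map_mono S.arrow
  Subobject.mk (F.map S.arrow)

end

open CategoryTheory CategoryTheory.Limits

section Lattice

/-- The slope of a complex number. -/
noncomputable def cslope (c : ℂ) : ℝ := c.im / c.re

theorem cslope_lt_cslope_add_iff {a b : ℂ} (ha : 0 < a.re) (hb : 0 < b.re) :
    cslope b < cslope (a + b) ↔ cslope b < cslope a := by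
  simp only [cslope, Complex.add_im, Complex.add_re]
  rw [div_lt_div_iff₀ hb (by positivity), div_lt_div_iff₀ hb ha]
  constructor <;> intro h <;> nlinarith

theorem cslope_add_lt_cslope_iff {a b : ℂ} (ha : 0 < a.re) (hb : 0 < b.re) :
    cslope (a + b) < cslope a ↔ cslope b < cslope a := by
  simp only [cslope, Complex.add_im, Complex.add_re]
  rw [div_lt_div_iff₀ (by positivity) ha, div_lt_div_iff₀ hb ha]
  constructor <;> intro h <;> nlinarith

variable {L : Type*} [Lattice L]

/-- A modular valuation on a lattice with values in `ℂ` whose real part is strictly monotone. -/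
structure IsStabVal (z : L → ℂ) : Prop where
  modular : ∀ S T, z (S ⊔ T) + z (S ⊓ T) = z S + z T
  strictMono : StrictMono fun S => (z S).re

/-- The slope of the interval `[S, T]`. -/
noncomputable def islope (z : L → ℂ) (S T : L) : ℝ := cslope (z T - z S)

/-- Semistability of the interval `[S, T]`. -/
def IntervalSemistable (z : L → ℂ) (S T : L) : Prop :=
  ∀ W, S < W → W ≤ T → islope z S W ≤ islope z S T

namespace IsStabVal

variable {z : L → ℂ}

theorem re_pos (hz : IsStabVal z) {S T : L} (h : S < T) : 0 < (z T - z S).re := by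
  have := hz.strictMono h
  simpa using this

theorem lt_left_iff (hz : IsStabVal z) {S W T : L} (h₁ : S < W) (h₂ : W < T) :
    islope z S T < islope z S W ↔ islope z W T < islope z S W := by
  have := cslope_add_lt_cslope_iff (hz.re_pos h₁) (hz.re_pos h₂)
  simpa [islope] using this

theorem right_lt_iff (hz : IsStabVal z) {S W T : L} (h₁ : S < W) (h₂ : W < T) :
    islope z W T < islope z S T ↔ islope z W T < islope z S W := by
  have := cslope_lt_cslope_add_iff (hz.re_pos h₁) (hz.re_pos h₂)
  simpa [islope] using this

theorem islope_inf_left (hz : IsStabVal z) (S T : L) :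
    islope z (S ⊓ T) S = islope z T (S ⊔ T) := by
  unfold islope
  congr 1
  linear_combination -hz.modular S T

theorem exists_semistable_of_wf (z : L → ℂ) (S : L)
    (wf : WellFounded fun W T => S < W ∧ W < T ∧ islope z S T < islope z S W) (T : L) (h : S < T) :
    IntervalSemistable z S T ∨
      ∃ W, S < W ∧ W < T ∧ IntervalSemistable z S W ∧ islope z S T < islope z S W := by
  induction T using wf.induction with
  | _ T ih =>
    by_cases hs : IntervalSemistable z S T
    · exact .inl hs
    · right
      simp only [IntervalSemistable, not_forall, not_le] at hs
      obtain ⟨W, hSW, hWT, hlt⟩ := hs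
      have hWT : W < T := lt_of_le_of_ne hWT (by rintro rfl; exact lt_irrefl _ hlt)
      obtain hW | ⟨W', h1, h2, h3, h4⟩ := ih W ⟨hSW, hWT, hlt⟩ hSW
      · exact ⟨W, hSW, hWT, hW, hlt⟩
      · exact ⟨W', h1, h2.trans hWT, h3, hlt.trans h4⟩

/-- Existence of maximally destabilizing quotients. -/
theorem exists_mdq (hz : IsStabVal z)
    (wf₁ : ∀ S : L, WellFounded fun W T => S < W ∧ W < T ∧ islope z S T < islope z S W)
    (T : L) (wf₂ : WellFounded fun W S => S < W ∧ W < T ∧ islope z W T < islope z S T)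
    (S : L) (h : S < T) :
    ∃ K, S ≤ K ∧ K < T ∧ ∀ K', S ≤ K' → K' < T →
      islope z K' T ≤ islope z K T → islope z K' T = islope z K T ∧ K ≤ K' := by
  induction S using wf₂.induction with
  | _ S ih =>
    obtain hs | ⟨W, hSW, hWT, hW, hlt⟩ := exists_semistable_of_wf z S (wf₁ S) T h
    · refine ⟨S, le_rfl, h, fun K' h1 h2 h3 => ?_⟩
      refine ⟨le_antisymm h3 ?_, h1⟩
      obtain rfl | h1 := h1.eq_or_lt
      · exact le_rfl
      by_contra! hc
      have := hs K' h1 h2.le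
      exact absurd ((hz.lt_left_iff h1 h2).2 ((hz.right_lt_iff h1 h2).1 hc)) this.not_gt
    · have hWT' : islope z W T < islope z S T :=
        (hz.right_lt_iff hSW hWT).2 ((hz.lt_left_iff hSW hWT).1 hlt)
      obtain ⟨K, hWK, hKT, hK⟩ := ih W ⟨hSW, hWT, hWT'⟩ hWT
      refine ⟨K, hSW.le.trans hWK, hKT, fun K' h1 h2 h3 => ?_⟩
      suffices W ≤ K' from hK K' this h2 h3
      have hKW : islope z K T ≤ islope z W T := by
        by_contra! hc
        exact hc.ne (hK W le_rfl hWT hc.le).1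
      have hK'W : islope z K' T < islope z S W :=
        h3.trans_lt (hKW.trans_lt (hWT'.trans hlt))
      by_contra hWK'
      have hinf : W ⊓ K' < W := lt_of_le_of_ne inf_le_left (by simpa using hWK')
      have hsup : K' < W ⊔ K' := lt_of_le_of_ne le_sup_right (by simpa [eq_comm] using hWK')
      have hquot : islope z S W ≤ islope z K' (W ⊔ K') := by
        rw [← hz.islope_inf_left]
        obtain he | hl := (le_inf hSW.le h1).eq_or_lt
        · rw [← he]
        by_contra! hc
        exact ((hz.lt_left_iff hl hinf).2 ((hz.right_lt_iff hl hinf).1 hc)).not_ge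
          (hW _ hl hinf.le)
      obtain he | hl := (sup_le hWT.le h2.le).eq_or_lt
      · rw [he] at hquot
        exact hquot.not_gt hK'W
      · have h4 : islope z (W ⊔ K') T < islope z K' T :=
          (hz.right_lt_iff hsup hl).2
            ((hz.lt_left_iff hsup hl).1 (hK'W.trans_le hquot))
        exact (h4.trans_le h3).ne (hK _ le_sup_left hl (h4.le.trans h3)).1

end IsStabVal

/-- A Harder–Narasimhan chain from `⊥` to `T`, with steps `F 0, …, F ℓ`. -/
structure IsHNChain [OrderBot L] (z : L → ℂ) (T : L) (ℓ : ℕ) (F : ℕ → L) : Prop where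
  zero : F 0 = ⊥
  last : F ℓ = T
  lt : ∀ i < ℓ, F i < F (i + 1)
  semistable : ∀ i < ℓ, IntervalSemistable z (F i) (F (i + 1))
  slopes : ∀ i j, i < j → j < ℓ → islope z (F j) (F (j + 1)) < islope z (F i) (F (i + 1))

theorem IsHNChain.snoc [OrderBot L] {z : L → ℂ} {K T : L} {ℓ : ℕ} {F : ℕ → L}
    (hF : IsHNChain z K ℓ F) (hKT : K < T) (hs : IntervalSemistable z K T)
    (hlast : ∀ i, i + 1 = ℓ → islope z K T < islope z (F i) K) :
    IsHNChain z T (ℓ + 1) (fun n => if n ≤ ℓ then F n else T) := by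
  have hslope : ∀ i < ℓ, islope z K T < islope z (F i) (F (i + 1)) := by
    intro i hi
    obtain ⟨m, rfl⟩ : ∃ m, ℓ = m + 1 := ⟨ℓ - 1, by omega⟩
    have hm := hlast m rfl
    obtain rfl | him := Nat.lt_succ_iff_lt_or_eq.1 hi |>.symm
    · rwa [hF.last]
    · refine hm.trans ?_
      have := hF.slopes i m him (by omega)
      rwa [hF.last] at this
  refine ⟨by simpa using hF.zero, by simp, fun i hi => ?_, fun i hi => ?_, fun i j hij hj => ?_⟩
  · obtain rfl | hi := Nat.lt_succ_iff_lt_or_eq.1 hi |>.symm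
    · simpa [hF.last] using hKT
    · simpa [hi.le, Nat.succ_le_iff.2 hi] using hF.lt i hi
  · obtain rfl | hi := Nat.lt_succ_iff_lt_or_eq.1 hi |>.symm
    · simpa [hF.last] using hs
    · simpa [hi.le, Nat.succ_le_iff.2 hi] using hF.semistable i hi
  · obtain rfl | hj := Nat.lt_succ_iff_lt_or_eq.1 hj |>.symm
    · simpa [hij.le, Nat.succ_le_iff.2 hij, hF.last] using hslope i hij
    · simpa [hj.le, Nat.succ_le_iff.2 hj, (hij.trans hj).le, Nat.succ_le_iff.2 (hij.trans hj)]
        using hF.slopes i j hij hj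

namespace IsStabVal

variable {z : L → ℂ}

theorem exists_isHNChain [OrderBot L] (hz : IsStabVal z)
    (wf₁ : ∀ S : L, WellFounded fun W T => S < W ∧ W < T ∧ islope z S T < islope z S W)
    (wf₂ : ∀ T : L, WellFounded fun W S => S < W ∧ W < T ∧ islope z W T < islope z S T)
    (T : L) (h : ⊥ < T) : ∃ ℓ F, IsHNChain z T ℓ F := by
  induction T using (wf₁ ⊥).induction with
  | _ T ih =>
    obtain ⟨K, -, hKT, hK⟩ := hz.exists_mdq wf₁ T (wf₂ T) ⊥ h
    have hs : IntervalSemistable z K T := by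
      intro W hKW hWT
      by_contra! hc
      have hWT : W < T := lt_of_le_of_ne hWT (by rintro rfl; exact lt_irrefl _ hc)
      have h1 := (hz.right_lt_iff hKW hWT).2 ((hz.lt_left_iff hKW hWT).1 hc)
      exact h1.ne (hK W bot_le hWT h1.le).1
    have hlt : ∀ K' < K, islope z K T < islope z K' K := by
      intro K' hK'
      by_contra! hc
      refine hK'.not_ge (hK K' bot_le (hK'.trans hKT) ?_).2
      by_contra! hc'
      exact ((hz.right_lt_iff hK' hKT).1 hc').not_ge hc
    obtain rfl | hK0 := eq_bot_or_bot_lt K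
    · refine ⟨1, _, IsHNChain.snoc (K := ⊥) (ℓ := 0) (F := fun _ => ⊥) ?_ hKT hs (by simp)⟩
      constructor <;> simp
    · obtain ⟨ℓ, F, hF⟩ := ih K
        ⟨hK0, hKT, (hz.lt_left_iff hK0 hKT).2 (hlt ⊥ hK0)⟩ hK0
      refine ⟨ℓ + 1, _, hF.snoc hKT hs ?_⟩
      rintro i rfl
      exact hlt _ (hF.last ▸ hF.lt i (by omega))

/-- The steps of a Harder–Narasimhan chain are the largest elements maximizing
`Im z - t * Re z`, for suitable real numbers `t`. -/
theorem _root_.IsHNChain.isGreatest_maximizer [BoundedOrder L] (hz : IsStabVal z) {ℓ : ℕ}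
    {F : ℕ → L} (hF : IsHNChain z ⊤ ℓ F) (t : ℝ) (i : ℕ) (hi : i ≤ ℓ)
    (h₁ : ∀ j < i, t ≤ islope z (F j) (F (j + 1)))
    (h₂ : ∀ j, i ≤ j → j < ℓ → islope z (F j) (F (j + 1)) < t) (S : L) :
    (z S).im - t * (z S).re ≤ (z (F i)).im - t * (z (F i)).re ∧
      ((z (F i)).im - t * (z (F i)).re ≤ (z S).im - t * (z S).re → S ≤ F i) := by
  have key : ∀ j < ℓ, ∃ W, F j ≤ W ∧ W ≤ F (j + 1) ∧ S ⊓ F (j + 1) ≤ W ∧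
      z (S ⊓ F (j + 1)) - z (S ⊓ F j) = z W - z (F j) := by
    intro j hj
    refine ⟨S ⊓ F (j + 1) ⊔ F j, le_sup_right, sup_le inf_le_right (hF.lt j hj).le,
      le_sup_left, ?_⟩
    have := hz.modular (S ⊓ F (j + 1)) (F j)
    rw [inf_assoc, inf_eq_right.2 (hF.lt j hj).le] at this
    linear_combination -this
  have low : ∀ j ≤ i, (z (S ⊓ F j)).im - t * (z (S ⊓ F j)).re ≤
      (z (F j)).im - t * (z (F j)).re := by
    intro j
    induction j with
    | zero => simp [hF.zero]
    | succ j ih =>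
      intro hj
      have ih := ih (by omega)
      obtain ⟨W, hW1, hW2, -, hW⟩ := key j (by omega)
      have him := congrArg Complex.im hW
      have hre := congrArg Complex.re hW
      simp only [Complex.sub_im, Complex.sub_re] at him hre
      have hlt := hF.lt j (by omega)
      have h0 := hz.re_pos hlt
      have ht := h₁ j (by omega)
      have hWF := hz.strictMono.monotone hW2
      have hst : (z W - z (F j)).im ≤ islope z (F j) (F (j + 1)) * (z W - z (F j)).re := by
        obtain rfl | hl := hW1.eq_or_lt
        · simp
        · have := hF.semistable j (by omega) W hl hW2
          rwa [islope, cslope, div_le_iff₀ (hz.re_pos hl)] at this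
      have hT : (z (F (j + 1)) - z (F j)).im =
          islope z (F j) (F (j + 1)) * (z (F (j + 1)) - z (F j)).re := by
        rw [islope, cslope, div_mul_cancel₀ _ h0.ne']
      simp only [Complex.sub_im, Complex.sub_re] at hst hT
      rw [sub_eq_iff_eq_add] at him hre
      rw [him, hre]
      nlinarith [mul_nonneg (sub_nonneg.2 ht) (sub_nonneg.2 hWF)]
  have high : ∀ j, i ≤ j → j ≤ ℓ → (z (S ⊓ F j)).im - t * (z (S ⊓ F j)).re ≤
      (z (F i)).im - t * (z (F i)).re ∧ ((z (F i)).im - t * (z (F i)).re ≤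
        (z (S ⊓ F j)).im - t * (z (S ⊓ F j)).re → S ⊓ F j ≤ F i) := by
    intro j hij
    induction j, hij using Nat.le_induction with
    | base => exact fun _ => ⟨low i le_rfl, fun _ => inf_le_right⟩
    | succ j hij ih =>
      intro hj
      have ih := ih (by omega)
      obtain ⟨W, hW1, hW2, hSW, hW⟩ := key j (by omega)
      obtain rfl | hl := hW1.eq_or_lt
      · have : S ⊓ F (j + 1) = S ⊓ F j :=
          le_antisymm (le_inf inf_le_left hSW) (inf_le_inf_left _ (hF.lt j (by omega)).le)
        rwa [this]
      · have him := congrArg Complex.im hW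
        have hre := congrArg Complex.re hW
        have h0 := hz.re_pos hl
        have ht := (hF.semistable j (by omega) W hl hW2).trans_lt (h₂ j hij (by omega))
        rw [islope, cslope, div_lt_iff₀ h0] at ht
        simp only [Complex.sub_im, Complex.sub_re] at him hre ht
        have : (z (S ⊓ F (j + 1))).im - t * (z (S ⊓ F (j + 1))).re <
          (z (F i)).im - t * (z (F i)).re := by
          rw [← him, ← hre] at ht
          linarith [ih.1]
        exact ⟨this.le, fun h => absurd this h.not_gt⟩
  simpa [hF.last] using high ℓ hi le_rfl

theorem _root_.IsHNChain.exists_eq [BoundedOrder L] (hz : IsStabVal z) {ℓ ℓ' : ℕ}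
    {F F' : ℕ → L} (hF : IsHNChain z ⊤ ℓ F) (hF' : IsHNChain z ⊤ ℓ' F') (i : ℕ) (hi : i ≤ ℓ) :
    ∃ i' ≤ ℓ', F i = F' i' := by
  obtain ⟨t, h₁, h₂⟩ : ∃ t : ℝ, (∀ j < i, t ≤ islope z (F j) (F (j + 1))) ∧
      (∀ j, i ≤ j → j < ℓ → islope z (F j) (F (j + 1)) < t) := by
    cases i with
    | zero =>
      refine ⟨islope z (F 0) (F 1) + 1, by simp, fun j _ hj => ?_⟩
      obtain rfl | h := Nat.eq_zero_or_pos j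
      · simp
      · linarith [hF.slopes 0 j h hj]
    | succ i =>
      refine ⟨islope z (F i) (F (i + 1)), fun j hj => ?_, fun j h hj => hF.slopes i j h hj⟩
      obtain rfl | h := Nat.lt_succ_iff_lt_or_eq.1 hj |>.symm
      · exact le_rfl
      · exact (hF.slopes j i h (by omega)).le
  obtain ⟨i', hi', h₁', h₂'⟩ : ∃ i' ≤ ℓ', (∀ j < i', t ≤ islope z (F' j) (F' (j + 1))) ∧
      (∀ j, i' ≤ j → j < ℓ' → islope z (F' j) (F' (j + 1)) < t) := by
    classical
    have hex : ∃ n, n < ℓ' → islope z (F' n) (F' (n + 1)) < t := ⟨ℓ', by simp⟩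
    refine ⟨Nat.find hex, Nat.find_min' hex (by simp), fun j hj => ?_, fun j hj hjl => ?_⟩
    · have := Nat.find_min hex hj
      push Not at this
      exact this.2
    · have h := Nat.find_spec hex (hj.trans_lt hjl)
      obtain he | hlt := hj.eq_or_lt
      · rwa [he] at h
      · exact (hF'.slopes _ j hlt hjl).trans h
  have hG := hF.isGreatest_maximizer hz t i hi h₁ h₂
  have hG' := hF'.isGreatest_maximizer hz t i' hi' h₁' h₂'
  exact ⟨i', hi', le_antisymm ((hG' _).2 (hG _).1) ((hG _).2 (hG' _).1)⟩

end IsStabVal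

end Lattice
section Subobject

variable {A : Type u} [Category.{v} A] [Abelian A]

namespace AddStab

variable (Z : AddStab A)

theorem val_isZero {X : A} (h : IsZero X) : Z.val X = 0 := by
  have := Z.additive (ShortComplex.mk (0 : X ⟶ X) (0 : X ⟶ X) (by simp))
    { exact := ShortComplex.exact_of_isZero_X₂ _ h
      mono_f := ⟨fun _ _ _ => h.eq_of_tgt _ _⟩
      epi_g := ⟨fun _ _ _ => h.eq_of_src _ _⟩ }
  simpa using this

theorem val_cokernel {X Y : A} (f : X ⟶ Y) [Mono f] :
    Z.val (cokernel f) = Z.val Y - Z.val X := by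
  have := Z.additive (ShortComplex.mk f (cokernel.π f) (by simp))
    { exact := ShortComplex.exact_cokernel f
      mono_f := by dsimp; infer_instance
      epi_g := by dsimp; infer_instance }
  simp only at this
  rw [this]; ring

theorem val_of_iso {X Y : A} (e : X ≅ Y) : Z.val X = Z.val Y := by
  have := Z.val_cokernel e.hom
  rw [Z.val_isZero (isZero_cokernel_of_epi e.hom)] at this
  exact (sub_eq_zero.1 this.symm).symm

theorem val_biprod (X Y : A) : Z.val (X ⊞ Y) = Z.val X + Z.val Y :=
  Z.additive _ (ShortComplex.Splitting.ofHasBinaryBiproduct X Y).shortExact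

/-- The class of a subobject of `X`. -/
noncomputable def subVal (X : A) (S : Subobject X) : ℂ := Z.val (S : A)

end AddStab

namespace CategoryTheory.Subobject

variable {X : A}

theorem isPullback_inf_sup (S T : Subobject X) :
    IsPullback (ofLE (S ⊓ T) S _root_.inf_le_left) (ofLE (S ⊓ T) T _root_.inf_le_right)
      (ofLE S (S ⊔ T) le_sup_left) (ofLE T (S ⊔ T) le_sup_right) :=
  ⟨⟨by simp⟩, ⟨PullbackCone.isLimitOfFactors S.arrow T.arrow (S ⊔ T).arrow _ _ (by simp) (by simp)
    (inf_isPullback S T).cone (inf_isPullback S T).isLimit⟩⟩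

theorem epi_desc_sup (S T : Subobject X) :
    Epi (biprod.desc (ofLE S (S ⊔ T) le_sup_left) (-ofLE T (S ⊔ T) le_sup_right)) := by
  set g := biprod.desc (ofLE S (S ⊔ T) le_sup_left) (-ofLE T (S ⊔ T) le_sup_right)
  have hle : S ⊔ T ≤ Subobject.mk (image.ι g ≫ (S ⊔ T).arrow) := by
    refine sup_le (le_mk_of_comm (biprod.inl ≫ factorThruImage g) ?_)
      (le_mk_of_comm (-biprod.inr ≫ factorThruImage g) ?_)
    · simp [g]
    · simp [g]
  have : IsSplitEpi (image.ι g) := by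
    refine ⟨⟨⟨ofLEMk _ _ hle, ?_⟩⟩⟩
    rw [← cancel_mono (S ⊔ T).arrow]
    simp
  rw [← image.fac g]
  exact epi_comp _ _

theorem mono_cokernel_map {S W T : Subobject X} (h₁ : S ≤ W) (h₂ : W ≤ T) :
    Mono (cokernel.map (ofLE S W h₁) (ofLE S T (h₁.trans h₂)) (𝟙 _) (ofLE W T h₂) (by simp)) :=
  Abelian.mono_cokernel_map_of_isPullback
    ⟨⟨by simp⟩, ⟨PullbackCone.IsLimit.mk _ (fun s => s.snd)
      (fun s => by
        rw [← cancel_mono (ofLE W T h₂), Category.assoc, ofLE_comp_ofLE, s.condition])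
      (fun s => Category.comp_id _) (fun s m _ h => by simpa using h)⟩⟩

theorem not_isZero_cokernel {S T : Subobject X} (h : S < T) :
    ¬ IsZero (cokernel (ofLE S T h.le)) := by
  intro h0
  have : Epi (ofLE S T h.le) := Preadditive.epi_of_isZero_cokernel _ h0
  have : IsIso (ofLE S T h.le) := isIso_of_mono_of_epi _
  refine h.not_ge (le_of_comm (inv (ofLE S T h.le)) ?_)
  simp

theorem exists_cokernel_iso {S T : Subobject X} (h : S ≤ T) {V : A}
    (ι : V ⟶ cokernel (ofLE S T h)) [Mono ι] :
    ∃ (W : Subobject X) (h₁ : S ≤ W) (_ : W ≤ T), Nonempty (V ≅ cokernel (ofLE S W h₁)) := by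
  let p : Limits.pullback ι (cokernel.π (ofLE S T h)) ⟶ X := pullback.snd _ _ ≫ T.arrow
  let W := Subobject.mk p
  have h₂ : W ≤ T := mk_le_of_comm (pullback.snd _ _) rfl
  have h₁ : S ≤ W := le_mk_of_comm (pullback.lift 0 (ofLE S T h) (by simp))
    (by dsimp only [p]; rw [pullback.lift_snd_assoc, ofLE_arrow])
  let g : (W : A) ⟶ V := (underlyingIso p).hom ≫ pullback.fst _ _
  have hg : g ≫ ι = ofLE W T h₂ ≫ cokernel.π (ofLE S T h) := by
    have : ofLE W T h₂ = (underlyingIso p).hom ≫ pullback.snd _ _ := by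
      rw [← cancel_mono T.arrow]
      simp only [ofLE_arrow, Category.assoc]
      exact (underlyingIso_hom_comp_eq_mk p).symm
    rw [this, Category.assoc, Category.assoc, pullback.condition]
  have hzero : ofLE S W h₁ ≫ g = 0 := by
    rw [← cancel_mono ι, Category.assoc, hg]
    simp
  have hex : (ShortComplex.mk _ _ hzero).Exact := by
    rw [ShortComplex.exact_iff_exact_up_to_refinements]
    intro B x hx
    have hx : x ≫ g = 0 := hx
    obtain ⟨B', π, hπ, y, hy⟩ := (ShortComplex.exact_cokernel
      (ofLE S T h)).exact_up_to_refinements (x ≫ ofLE W T h₂)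
        (by dsimp; rw [Category.assoc, ← hg, reassoc_of% hx, zero_comp])
    refine ⟨B', π, hπ, y, ?_⟩
    dsimp at y hy ⊢
    rw [← cancel_mono (ofLE W T h₂)]
    simpa using hy
  have : Epi (ShortComplex.mk _ _ hzero).g := by
    dsimp [g]
    infer_instance
  exact ⟨W, h₁, h₂, ⟨hex.gIsCokernel.coconePointUniqueUpToIso (colimit.isColimit _)⟩⟩

end CategoryTheory.Subobject

namespace AddStab

variable (Z : AddStab A)

theorem isStabVal (X : A) : IsStabVal (Z.subVal X) where
  modular S T := by
    have sq := Subobject.isPullback_inf_sup S T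
    have := Z.additive sq.shortComplex'
      { exact := sq.exact_shortComplex'
        mono_f := sq.mono_shortComplex'_f
        epi_g := Subobject.epi_desc_sup S T }
    simp only [CommSq.shortComplex'] at this
    rw [Z.val_biprod] at this
    simp only [subVal]
    rw [this, add_comm]
  strictMono S T h := by
    have := Z.posRe _ (Subobject.not_isZero_cokernel h)
    rw [Z.val_cokernel] at this
    simpa [subVal] using this

theorem slopeObj_cokernel {X : A} {S T : Subobject X} (h : S ≤ T) :
    slopeObj Z.val (cokernel (Subobject.ofLE S T h)) = islope (Z.subVal X) S T := by
  rw [slopeObj, Z.val_cokernel]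
  rfl

theorem semistableF_cokernel_iff {X : A} {S T : Subobject X} (h : S ≤ T) :
    SemistableF Z.val (cokernel (Subobject.ofLE S T h)) ↔
      IntervalSemistable (Z.subVal X) S T := by
  constructor
  · intro hs W h₁ h₂
    have := hs _ _ (Subobject.mono_cokernel_map h₁.le h₂) (Subobject.not_isZero_cokernel h₁)
    rwa [slopeObj_cokernel, slopeObj_cokernel] at this
  · intro hs V ι _ hV
    obtain ⟨W, h₁, h₂, ⟨e⟩⟩ := Subobject.exists_cokernel_iso h ι
    rw [slopeObj, Z.val_of_iso e, ← slopeObj, slopeObj_cokernel, slopeObj_cokernel]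
    obtain rfl | hl := h₁.eq_or_lt
    · refine absurd (IsZero.of_iso ?_ e) hV
      simp only [Subobject.ofLE_refl]
      exact isZero_cokernel_of_epi _
    · exact hs W hl h₂

theorem isHNFilt_iff {X : A} {ℓ : ℕ} (F : ℕ → Subobject X) :
    IsHNFilt Z.val X (fun i : Fin (ℓ + 1) => F i) ↔ IsHNChain (Z.subVal X) ⊤ ℓ F := by
  have key (hlt : ∀ i < ℓ, F i < F (i + 1)) (i : Fin ℓ) :
      slopeObj Z.val (hnQuot (fun i : Fin (ℓ + 1) => F i) i) =
        islope (Z.subVal X) (F i) (F (i + 1)) ∧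
      (SemistableF Z.val (hnQuot (fun i : Fin (ℓ + 1) => F i) i) ↔
        IntervalSemistable (Z.subVal X) (F i) (F (i + 1))) := by
    rw [hnQuot, slopeObj_cokernel, semistableF_cokernel_iff]
    simp [inf_eq_left.2 (hlt i i.2).le]
  constructor
  · intro h
    have hlt : ∀ i < ℓ, F i < F (i + 1) := fun i hi => h.lt ⟨i, hi⟩
    refine ⟨h.bot, h.top, hlt, fun i hi => ?_, fun i j hij hj => ?_⟩
    · exact (key hlt ⟨i, hi⟩).2.1 (h.semistable ⟨i, hi⟩)
    · have := h.slopes ⟨i, hij.trans hj⟩ ⟨j, hj⟩ hij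
      rwa [(key hlt _).1, (key hlt _).1] at this
  · intro h
    refine ⟨h.zero, h.last, fun i => h.lt i i.2, fun i => ?_, fun i j hij => ?_⟩
    · exact (key h.lt i).2.2 (h.semistable i i.2)
    · rw [(key h.lt _).1, (key h.lt _).1]
      exact h.slopes i j hij j.2

theorem _root_.IsHNFilt.isHNChain {Z : AddStab A} {X : A} {ℓ : ℕ} {F : Fin (ℓ + 1) → Subobject X}
    (hF : IsHNFilt Z.val X F) :
    IsHNChain (Z.subVal X) ⊤ ℓ (fun n => F (Fin.ofNat (ℓ + 1) n)) := by
  rw [← isHNFilt_iff]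
  simpa using hF

theorem range_subset {X : A} {ℓ ℓ' : ℕ} {F : Fin (ℓ + 1) → Subobject X}
    {F' : Fin (ℓ' + 1) → Subobject X} (hF : IsHNFilt Z.val X F) (hF' : IsHNFilt Z.val X F') :
    Set.range F ⊆ Set.range F' := by
  rintro _ ⟨i, rfl⟩
  obtain ⟨i', -, h⟩ := hF.isHNChain.exists_eq (Z.isStabVal X) hF'.isHNChain i i.is_le
  exact ⟨_, by simpa using h.symm⟩

theorem wellFounded_sub (h : ¬ ∃ (V : ℕ → A) (f : ∀ j : ℕ, V (j + 1) ⟶ V j),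
      (∀ j, Mono (f j)) ∧ (∀ j, ¬ IsZero (V j)) ∧
      (∀ j, slopeObj Z.val (V j) < slopeObj Z.val (V (j + 1))))
    (X : A) (S : Subobject X) :
    WellFounded fun W T => S < W ∧ W < T ∧
      islope (Z.subVal X) S T < islope (Z.subVal X) S W := by
  rw [wellFounded_iff_isEmpty_descending_chain]
  refine ⟨fun ⟨W, hW⟩ => h ?_⟩
  have hS : ∀ n, S < W n := fun n => (hW n).1.trans (hW n).2.1
  refine ⟨fun n => cokernel (Subobject.ofLE S (W n) (hS n).le), fun n => _,
    fun n => Subobject.mono_cokernel_map (hS (n + 1)).le (hW n).2.1.le,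
    fun n => Subobject.not_isZero_cokernel (hS n), fun n => ?_⟩
  simpa only [slopeObj_cokernel] using (hW n).2.2

theorem wellFounded_quot (h : ¬ ∃ (V : ℕ → A) (f : ∀ j : ℕ, V j ⟶ V (j + 1)),
      (∀ j, Epi (f j)) ∧ (∀ j, ¬ IsZero (V j)) ∧
      (∀ j, slopeObj Z.val (V (j + 1)) < slopeObj Z.val (V j)))
    (X : A) (T : Subobject X) :
    WellFounded fun W S => S < W ∧ W < T ∧
      islope (Z.subVal X) W T < islope (Z.subVal X) S T := by
  rw [wellFounded_iff_isEmpty_descending_chain]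
  refine ⟨fun ⟨W, hW⟩ => h ?_⟩
  have hT : ∀ n, W n < T := fun n => (hW n).1.trans (hW n).2.1
  refine ⟨fun n => cokernel (Subobject.ofLE (W n) T (hT n).le),
    fun n => cokernel.map _ _ (Subobject.ofLE _ _ (hW n).1.le) (𝟙 _) (by simp),
    fun n => ?_, fun n => Subobject.not_isZero_cokernel (hT n), fun n => ?_⟩
  · refine epi_of_epi_fac (f := cokernel.π _) (h := cokernel.π _) ?_
    simp
  · simpa only [slopeObj_cokernel] using (hW n).2.2

end AddStab

end Subobject

/-- (i) Harder–Narasimhan filtrations along a stability condition are unique when they exist.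
(ii) If the abelian category `A` has no infinite chain of subobjects of strictly increasing
slopes and no infinite chain of quotients of strictly decreasing slopes, then every nonzero
object of `A` has a (unique) HN filtration along `Z`. -/
theorem hn_unique_and_exists {A : Type u} [Category.{v} A] [Abelian A] (Z : AddStab A) :
    (∀ (X : A) (ℓ ℓ' : ℕ) (F : Fin (ℓ + 1) → Subobject X) (F' : Fin (ℓ' + 1) → Subobject X),
      IsHNFilt Z.val X F → IsHNFilt Z.val X F' →
        ℓ = ℓ' ∧ ∀ (k : ℕ) (h : k < ℓ + 1) (h' : k < ℓ' + 1), F ⟨k, h⟩ = F' ⟨k, h'⟩) ∧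
    ((¬ ∃ (V : ℕ → A) (f : ∀ j : ℕ, V (j + 1) ⟶ V j),
        (∀ j, Mono (f j)) ∧ (∀ j, ¬ IsZero (V j)) ∧
        (∀ j, slopeObj Z.val (V j) < slopeObj Z.val (V (j + 1)))) →
     (¬ ∃ (V : ℕ → A) (f : ∀ j : ℕ, V j ⟶ V (j + 1)),
        (∀ j, Epi (f j)) ∧ (∀ j, ¬ IsZero (V j)) ∧
        (∀ j, slopeObj Z.val (V (j + 1)) < slopeObj Z.val (V j))) →
     ∀ X : A, ¬ IsZero X →
        ∃ (ℓ : ℕ) (F : Fin (ℓ + 1) → Subobject X), IsHNFilt Z.val X F) := by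
  refine ⟨fun X ℓ ℓ' F F' hF hF' => ?_, fun h₁ h₂ X hX => ?_⟩
  · have hmono := Fin.strictMono_iff_lt_succ.2 hF.lt
    have hmono' := Fin.strictMono_iff_lt_succ.2 hF'.lt
    have hr : Set.range F = Set.range F' :=
      (Z.range_subset hF hF').antisymm (Z.range_subset hF' hF)
    obtain rfl : ℓ = ℓ' := by
      have := congrArg Set.ncard hr
      simpa [← Set.image_univ, Set.ncard_image_of_injective, hmono.injective, hmono'.injective,
        Set.ncard_univ] using this
    obtain rfl := (hmono.range_inj hmono').1 hr
    exact ⟨rfl, fun _ _ _ => rfl⟩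
  · have hbot : (⊥ : Subobject X) < ⊤ := by
      refine bot_lt_iff_ne_bot.2 fun h => hX ?_
      rwa [Subobject.top_eq_id, Subobject.mk_eq_bot_iff_zero, ← IsZero.iff_id_eq_zero] at h
    obtain ⟨ℓ, F, hF⟩ := (Z.isStabVal X).exists_isHNChain (Z.wellFounded_sub h₁ X)
      (Z.wellFounded_quot h₂ X) ⊤ hbot
    exact ⟨ℓ, _, (Z.isHNFilt_iff F).2 hF⟩
end

section
/- Let Q be an upper semilattice, f : P ↪ Q the inclusion of a finite upper semilattice, U a P-persistence module, and W a submodule of the pushforward f_*U. Then the pixelisation f_*f^*W is a submodule of W: the linear maps φ_q = W_{f(⌊q⌋_f) ≤ q}, whose domains are (f_*f^*W)_q = (f^*W)_{⌊q⌋_f}, are injective and assemble into a monomorphism of Q-persistence modules f_*f^*W ↪ W. -/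
set_option maxHeartbeats 1000000

noncomputable section

variable {K : Type} [Field K] {Q : Type} [SemilatticeSup Q]

open Classical in
/-- The floor `⌊q⌋_S` of `q` for the finite sup-closed subset `S`: the join of all
elements of `S` below `q` (defined when at least one exists). -/
noncomputable def floorPt (S : Finset Q) (q : Q) (h : (S.filter (fun p => p ≤ q)).Nonempty) :
    Q := (S.filter (fun p => p ≤ q)).sup' h id

open Classical in
theorem floorPt_le (S : Finset Q) (q : Q) (h : (S.filter (fun p => p ≤ q)).Nonempty) :
    floorPt S q h ≤ q :=
  Finset.sup'_le h id fun p hp => (Finset.mem_filter.mp hp).2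

open Classical in
/-- The pixelisation `f_* f^* W` of a persistence submodule `W ⊆ f_* U`: at `q`, the image
of `W_{⌊q⌋_S}` under the structure map `V_{⌊q⌋_S ≤ q}` (and `0` when `⌊q⌋_S = -∞`). -/
noncomputable def pixCarrier {V : PersMod K Q} (S : Finset Q) (W : PersSubmod V) (q : Q) :
    Submodule K (V.space q) :=
  if h : (S.filter (fun p => p ≤ q)).Nonempty then
    (W.carrier (floorPt S q h)).map (V.map (floorPt_le S q h))
  else ⊥

open Classical in
theorem le_floorPt_iff (S : Finset Q) (q : Q) (h : (S.filter (fun p => p ≤ q)).Nonempty)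
    {p : Q} (hp : p ∈ S) : p ≤ floorPt S q h ↔ p ≤ q :=
  ⟨fun hpq => hpq.trans (floorPt_le S q h),
    fun hpq => Finset.le_sup' id (Finset.mem_filter.mpr ⟨hp, hpq⟩)⟩

open Classical in
theorem floorPt_mono (S : Finset Q) {q q' : Q} (hq : q ≤ q')
    (h : (S.filter (fun p => p ≤ q)).Nonempty) (h' : (S.filter (fun p => p ≤ q')).Nonempty) :
    floorPt S q h ≤ floorPt S q' h' :=
  Finset.sup'_mono id (Finset.monotone_filter_right S fun _ _ hp => hp.trans hq) h

theorem pixCarrier_le {V : PersMod K Q} (S : Finset Q) (W : PersSubmod V) (q : Q) :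
    pixCarrier S W q ≤ W.carrier q := by
  unfold pixCarrier
  split_ifs
  · exact W.stable _
  · exact bot_le

open Classical in
theorem map_pixCarrier_le {V : PersMod K Q} (S : Finset Q) (W : PersSubmod V) {q q' : Q}
    (hq : q ≤ q') : (pixCarrier S W q).map (V.map hq) ≤ pixCarrier S W q' := by
  by_cases h : (S.filter (fun p => p ≤ q)).Nonempty
  · have h' : (S.filter (fun p => p ≤ q')).Nonempty :=
      h.mono (Finset.monotone_filter_right S fun _ _ hp => hp.trans hq)
    rw [pixCarrier, pixCarrier, dif_pos h, dif_pos h',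
      ← Submodule.map_comp, ← V.map_trans,
      V.map_trans (floorPt_mono S hq h h')
        (floorPt_le S q' h'), Submodule.map_comp]
    exact Submodule.map_mono (W.stable _)
  · rw [pixCarrier, dif_neg h, Submodule.map_bot]
    exact bot_le

open Classical in
/-- Let `Q` be an upper semilattice, `f : P ↪ Q` the inclusion of a
finite (sup-closed) subposet `S`, `U` a `P`-persistence module (presented via its
pushforward, an `S`-discretised module `V = f_* U`), and `W` a persistence submodule of
`f_* U`. Then the pixelisation `f_* f^* W` is a submodule of `W`: the maps
`φ_q = W_{f(⌊q⌋_f) ≤ q}`, with domains `(f_* f^* W)_q = (f^* W)_{⌊q⌋_f}`, are injective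
and assemble into a monomorphism of `Q`-persistence modules `f_* f^* W ↪ W`. -/
theorem pixelisation_is_submodule
    (K : Type) [Field K] (Q : Type) [SemilatticeSup Q]
    (S : Finset Q) (hS : SupClosed (S : Set Q))
    (V : PersMod K Q) (hV : IsFinSLDiscretisedBy K S V) (W : PersSubmod V) :
    (∀ (q : Q) (h : (S.filter (fun p => p ≤ q)).Nonempty),
        Set.InjOn (V.map (floorPt_le S q h)) (W.carrier (floorPt S q h))) ∧
    (∀ (q q' : Q) (h : q ≤ q'),
        (pixCarrier S W q).map (V.map h) ≤ pixCarrier S W q') ∧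
    (∀ q : Q, pixCarrier S W q ≤ W.carrier q) := by
  exact ⟨fun q h => (hV.2 _ _ (floorPt_le S q h) fun _ hp =>
      le_floorPt_iff S q h hp).injective.injOn,
    fun _ _ hq => map_pixCarrier_le S W hq, pixCarrier_le S W⟩

end
end
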